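/- arXiv:1904.01203 — 8 statements merged into one kernel-verified Lean document; each statement's English description precedes it below -/
import Mathlib

section
/- Let ℓ : ℕ and let T, T' : ℕ satisfy T + 1 ≤ T' and T' < 2^ℓ. Then there exists a bitstring ṽ ∈ CTNodes(ℓ, T) such that ṽ is a prefix of v_{T'} (i.e. ṽ ∈ Path(v_{T'})) and ṽ ≠ v_T. -/
/-- The leaf of the depth-`ℓ` complete binary tree assigned to time `T`:
the big-endian `ℓ`-bit binary representation of `T`. -/
def leaf (ℓ T : ℕ) : List Bool :=
  (List.range ℓ).map (fun i => T.testBit (ℓ - 1 - i))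

/-- `PathSet v` is the set of prefixes of `v` (from the root to `v`). -/
def PathSet (v : List Bool) : Set (List Bool) :=
  {p | p <+: v}

/-- `Parent v` is `v` with its last bit removed. -/
def Parent (v : List Bool) : List Bool :=
  v.dropLast

/-- `RightSibling S = { Parent v ++ [true] : v ∈ S, v ≠ [] }`. -/
def RightSibling (S : Set (List Bool)) : Set (List Bool) :=
  {w | ∃ v ∈ S, v ≠ [] ∧ w = Parent v ++ [true]}

/-- Wei et al.'s (corrected) `CTNodes` set:
`(RightSibling(PathSet(v_T)) \ PathSet(Parent(v_T))) ∪ {v_T}`. -/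
def CTNodes (ℓ T : ℕ) : Set (List Bool) :=
  (RightSibling (PathSet (leaf ℓ T)) \ PathSet (Parent (leaf ℓ T))) ∪ {leaf ℓ T}

theorem leaf_succ (ℓ T : ℕ) : leaf (ℓ + 1) T = leaf ℓ (T / 2) ++ [T.testBit 0] := by
  simp only [leaf, List.range_succ, List.map_append, List.map_cons, List.map_nil]
  congr 1
  · apply List.map_congr_left
    intro i hi
    rw [List.mem_range] at hi
    rw [← Nat.testBit_succ]
    congr 1
    omega
  · simp

/-- The leaves of two times `T < T'` branch at a node `p`, `T` to the left and `T'` to the right. -/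
theorem exists_branch_of_lt {ℓ T T' : ℕ} (hlt : T < T') (hT' : T' < 2 ^ ℓ) :
    ∃ p, p ++ [false] <+: leaf ℓ T ∧ p ++ [true] <+: leaf ℓ T' := by
  induction ℓ generalizing T T' with
  | zero => omega
  | succ ℓ ih =>
    rw [leaf_succ, leaf_succ]
    by_cases h : T / 2 < T' / 2
    · obtain ⟨p, hp, hp'⟩ := ih h (by omega)
      exact ⟨p, hp.trans (List.prefix_append _ _), hp'.trans (List.prefix_append _ _)⟩
    · have hdiv : T / 2 = T' / 2 := by omega
      have h0 : T.testBit 0 = false := by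
        rw [Nat.testBit_zero]
        exact decide_eq_false (by omega)
      have h1 : T'.testBit 0 = true := by
        rw [Nat.testBit_zero]
        exact decide_eq_true (by omega)
      rw [h0, h1, hdiv]
      exact ⟨_, List.prefix_rfl, List.prefix_rfl⟩

/-- If `T + 1 ≤ T' < 2^ℓ`, then some node `vtil ∈ CTNodes(ℓ, T)` is a prefix of
the leaf `v_{T'}` yet `vtil ≠ v_T`. -/
theorem ctnodes_later_time_prefix_ne_leaf (ℓ T T' : ℕ)
    (hTT' : T + 1 ≤ T') (hT' : T' < 2 ^ ℓ) :
    ∃ vtil ∈ CTNodes ℓ T, vtil <+: leaf ℓ T' ∧ vtil ≠ leaf ℓ T := by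
  obtain ⟨p, hp, hp'⟩ := exists_branch_of_lt hTT' hT'
  have hnot : ¬ p ++ [true] <+: leaf ℓ T := by
    intro h
    have heq := (List.prefix_of_prefix_length_le h hp (by simp)).eq_of_length (by simp)
    simp at heq
  refine ⟨p ++ [true], Or.inl ⟨⟨p ++ [false], hp, by simp, by simp [Parent]⟩, ?_⟩, hp', ?_⟩
  · intro h
    exact hnot (List.IsPrefix.trans h (List.dropLast_prefix _))
  · intro h
    exact hnot (h ▸ List.prefix_rfl)
end

section
/- Let ℓ : ℕ and let T, T'' : ℕ satisfy T ≤ T'' and T'' < 2^ℓ. Then there exists a bitstring v ∈ CTNodes(ℓ, T) such that v is a prefix of v_{T''}. -/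
theorem Nat.exists_testBit_of_lt {m n : ℕ} (h : m < n) :
    ∃ i, m.testBit i = false ∧ n.testBit i = true ∧
      ∀ j, i < j → m.testBit j = n.testBit j := by
  obtain ⟨i, hi, hj⟩ := Nat.exists_most_significant_bit (n := m ^^^ n)
    (fun h0 => h.ne (Nat.xor_eq_zero_iff.mp h0))
  have agree : ∀ j, i < j → m.testBit j = n.testBit j := fun j hij => by
    simpa using hj j hij
  rw [Nat.testBit_xor] at hi
  cases hm : m.testBit i
  · exact ⟨i, hm, by simpa [hm] using hi, agree⟩
  · have hn : n.testBit i = false := by simpa [hm] using hi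
    exact absurd h (Nat.lt_of_testBit i hn hm fun j hij => (agree j hij).symm).not_gt

theorem length_leaf (ℓ T : ℕ) : (leaf ℓ T).length = ℓ := by
  simp [leaf]

theorem take_leaf_succ {ℓ k : ℕ} (T : ℕ) (hk : k < ℓ) :
    (leaf ℓ T).take (k + 1) = (leaf ℓ T).take k ++ [T.testBit (ℓ - 1 - k)] := by
  rw [List.take_succ_eq_append_getElem (by simpa [length_leaf] using hk)]
  simp [leaf]

theorem take_leaf_congr {ℓ k m n : ℕ} (h : ∀ j, ℓ ≤ j + k → m.testBit j = n.testBit j) :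
    (leaf ℓ m).take k = (leaf ℓ n).take k := by
  simp only [leaf, ← List.map_take, List.take_range]
  refine List.map_congr_left fun i hi => h _ ?_
  rw [List.mem_range] at hi
  omega

theorem take_leaf_append_true_mem_CTNodes {ℓ k T : ℕ} (hk : k < ℓ)
    (h : T.testBit (ℓ - 1 - k) = false) : (leaf ℓ T).take k ++ [true] ∈ CTNodes ℓ T := by
  have hs := take_leaf_succ T hk
  rw [h] at hs
  refine Or.inl ⟨⟨(leaf ℓ T).take (k + 1), List.take_prefix _ _, by simp [hs], ?_⟩,
    fun hp => ?_⟩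
  · simp [Parent, hs]
  · have hp' : (leaf ℓ T).take k ++ [true] <+: leaf ℓ T := hp.trans (List.dropLast_prefix _)
    rw [List.prefix_iff_eq_take] at hp'
    simp [length_leaf, hk.le, hs] at hp'

/-- If `T ≤ T'' < 2^ℓ`, then some node `v ∈ CTNodes(ℓ, T)` is a prefix of
the leaf `v_{T''}`. -/
theorem ctnodes_covers_later_leaf (ℓ T T'' : ℕ)
    (hTT'' : T ≤ T'') (hT'' : T'' < 2 ^ ℓ) :
    ∃ v ∈ CTNodes ℓ T, v <+: leaf ℓ T'' := by
  rcases hTT''.eq_or_lt with rfl | hlt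
  · exact ⟨leaf ℓ T, Or.inr rfl, List.prefix_rfl⟩
  obtain ⟨i, hT, hT2, hagree⟩ := Nat.exists_testBit_of_lt hlt
  have hi : i < ℓ := (Nat.pow_lt_pow_iff_right one_lt_two).mp
    ((Nat.ge_two_pow_of_testBit hT2).trans_lt hT'')
  have hsub : ℓ - 1 - (ℓ - 1 - i) = i := by omega
  refine ⟨_, take_leaf_append_true_mem_CTNodes (k := ℓ - 1 - i) (by omega)
    (by rw [hsub, hT]), ?_⟩
  rw [take_leaf_congr (n := T'') fun j hj => hagree j (by omega)]
  have hs := take_leaf_succ T'' (show ℓ - 1 - i < ℓ by omega)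
  rw [hsub, hT2] at hs
  exact hs ▸ List.take_prefix _ _
end

section
/- Let ℓ : ℕ and let T, T' : ℕ satisfy T ≤ T' and T' < 2^ℓ. Then there is exactly one bitstring in the intersection CTNodes(ℓ, T) ∩ Path(v_{T'}); that is, exactly one element of CTNodes(ℓ, T) is a prefix of v_{T'}. -/
/-- The leaves of two ordered times first differ by a `false` against a `true`. -/
theorem eq_or_exists_leaf_eq_append {ℓ T T' : ℕ} (h : T ≤ T') (hT' : T' < 2 ^ ℓ) :
    T = T' ∨ ∃ p r s, leaf ℓ T = p ++ false :: r ∧ leaf ℓ T' = p ++ true :: s := by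
  induction ℓ generalizing T T' with
  | zero => left; simp at hT'; omega
  | succ ℓ ih =>
    rw [leaf_succ, leaf_succ]
    rcases ih (Nat.div_le_div_right (c := 2) h) (by omega) with h2 | ⟨p, r, s, hr, hs⟩
    · by_cases he : T = T'
      · exact Or.inl he
      · refine Or.inr ⟨leaf ℓ (T / 2), [], [], ?_, ?_⟩
        · have : T % 2 = 0 := by omega
          simp [Nat.testBit_zero, this]
        · have : T' % 2 = 1 := by omega
          simp [Nat.testBit_zero, this, h2]
    · exact Or.inr ⟨p, r ++ [T.testBit 0], s ++ [T'.testBit 0], by simp [hr], by simp [hs]⟩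

theorem mem_CTNodes_iff {ℓ T : ℕ} {w : List Bool} :
    w ∈ CTNodes ℓ T ↔ w = leaf ℓ T ∨ ∃ p, w = p ++ [true] ∧ p ++ [false] <+: leaf ℓ T := by
  simp only [CTNodes, Set.mem_union, Set.mem_sdiff, Set.mem_singleton_iff, RightSibling, PathSet,
    Parent, Set.mem_ofPred_eq]
  constructor
  · rintro (⟨⟨v, hv, hne, rfl⟩, hn⟩ | rfl)
    · obtain ⟨p, b, rfl⟩ := List.eq_nil_or_concat v |>.resolve_left hne
      rw [List.concat_eq_append] at *
      rw [List.dropLast_concat] at *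
      cases b with
      | false => exact Or.inr ⟨p, rfl, hv⟩
      | true =>
        left
        obtain ⟨t, ht⟩ := hv
        rcases List.eq_nil_or_concat t with rfl | ⟨t, c, rfl⟩
        · simpa using ht
        · refine absurd ⟨t, ?_⟩ hn
          rw [← ht, List.concat_eq_append, ← List.append_assoc, List.dropLast_concat]
    · exact Or.inl rfl
  · rintro (rfl | ⟨p, rfl, hp⟩)
    · exact Or.inr rfl
    · refine Or.inl ⟨⟨p ++ [false], hp, by simp, by simp⟩, fun hn => ?_⟩
      have := List.prefix_of_prefix_length_le hp (hn.trans (List.dropLast_prefix _)) (by simp)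
      simp at this

theorem eq_of_concat_prefix_append {p q r s : List Bool} (hr : q ++ [false] <+: p ++ false :: r)
    (hs : q ++ [true] <+: p ++ true :: s) : q = p := by
  induction p generalizing q with
  | nil =>
    cases q with
    | nil => rfl
    | cons b q => simp_all [List.cons_prefix_cons]
  | cons a p ih =>
    cases q with
    | nil => simp_all [List.cons_prefix_cons]
    | cons b q =>
      simp only [List.cons_append, List.cons_prefix_cons] at hr hs
      rw [hr.1, ih hr.2 hs.2]

/-- If `T ≤ T' < 2^ℓ`, then exactly one element of `CTNodes(ℓ, T)` is a
prefix of the leaf `v_{T'}`. -/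
theorem ctnodes_inter_path_unique (ℓ T T' : ℕ)
    (hTT' : T ≤ T') (hT' : T' < 2 ^ ℓ) :
    ∃! v, v ∈ CTNodes ℓ T ∧ v <+: leaf ℓ T' := by
  rcases eq_or_exists_leaf_eq_append hTT' hT' with rfl | ⟨p, r, s, hr, hs⟩
  · refine ⟨leaf ℓ T, ⟨mem_CTNodes_iff.2 (Or.inl rfl), List.prefix_rfl⟩, ?_⟩
    rintro w ⟨hw, hpre⟩
    rcases mem_CTNodes_iff.1 hw with rfl | ⟨q, rfl, hq⟩
    · rfl
    · have := List.prefix_of_prefix_length_le hq hpre (by simp)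
      simp at this
  · refine ⟨p ++ [true], ⟨mem_CTNodes_iff.2 (Or.inr ⟨p, rfl, ?_⟩), ?_⟩, ?_⟩
    · simp [hr]
    · simp [hs]
    · rintro w ⟨hw, hpre⟩
      rw [hs] at hpre
      rcases mem_CTNodes_iff.1 hw with rfl | ⟨q, rfl, hq⟩
      · rw [hr, List.prefix_append_right_inj] at hpre
        simp at hpre
      · rw [hr] at hq
        rw [eq_of_concat_prefix_append hq hpre]
end

section
/- Let ℓ : ℕ and let T, T'' : ℕ satisfy T < 2^ℓ and T'' < 2^ℓ. If some bitstring v ∈ CTNodes(ℓ, T) is a prefix of v_{T''}, then T ≤ T''. (Forward security of the corrected CTNodes: no node usable at time T gives access to a leaf for a strictly earlier time.) -/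
theorem testBit_eq_of_prefix_leaf {ℓ T i : ℕ} {p : List Bool} (h : p <+: leaf ℓ T)
    (hi : i < p.length) : T.testBit (ℓ - 1 - i) = p[i] := by
  rw [h.getElem hi]
  simp [leaf]

theorem leaf_injOn (ℓ : ℕ) : Set.InjOn (leaf ℓ) {T | T < 2 ^ ℓ} := by
  intro S hS T hT h
  refine Nat.eq_of_testBit_eq fun j => ?_
  by_cases hj : j < ℓ
  · have hlen : ℓ - 1 - j < (leaf ℓ T).length := by rw [length_leaf]; omega
    have hST := (testBit_eq_of_prefix_leaf (ℓ := ℓ) (T := S) (h ▸ List.prefix_rfl) hlen).trans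
      (testBit_eq_of_prefix_leaf (List.prefix_refl _) hlen).symm
    rwa [show ℓ - 1 - (ℓ - 1 - j) = j by omega] at hST
  · have hpow : 2 ^ ℓ ≤ 2 ^ j := Nat.pow_le_pow_right two_pos (not_lt.mp hj)
    rw [Nat.testBit_lt_two_pow (lt_of_lt_of_le hS hpow),
      Nat.testBit_lt_two_pow (lt_of_lt_of_le hT hpow)]

theorem lt_of_siblings_prefix_leaf {ℓ S T : ℕ} {q : List Bool}
    (hS : S < 2 ^ ℓ) (hT : T < 2 ^ ℓ)
    (hqS : q ++ [false] <+: leaf ℓ S) (hqT : q ++ [true] <+: leaf ℓ T) : S < T := by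
  have hlen : q.length < ℓ := by simpa [length_leaf] using hqS.length_le
  refine Nat.lt_of_testBit (ℓ - 1 - q.length) ?_ ?_ fun j hj => ?_
  · simpa using testBit_eq_of_prefix_leaf hqS (i := q.length) (by simp)
  · simpa using testBit_eq_of_prefix_leaf hqT (i := q.length) (by simp)
  · by_cases hjℓ : j < ℓ
    · have hi : ℓ - 1 - j < q.length := by omega
      have hST := (testBit_eq_of_prefix_leaf ((List.prefix_append _ _).trans hqS) hi).trans
        (testBit_eq_of_prefix_leaf ((List.prefix_append _ _).trans hqT) hi).symm
      rwa [show ℓ - 1 - (ℓ - 1 - j) = j by omega] at hST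
    · have hpow : 2 ^ ℓ ≤ 2 ^ j := Nat.pow_le_pow_right two_pos (not_lt.mp hjℓ)
      rw [Nat.testBit_lt_two_pow (hS.trans_le hpow), Nat.testBit_lt_two_pow (hT.trans_le hpow)]

theorem prefix_dropLast_of_prefix_of_ne {α : Type*} {p v : List α} (h : p <+: v) (hne : p ≠ v) :
    p <+: v.dropLast := by
  have hlt : p.length < v.length :=
    lt_of_le_of_ne h.length_le fun hlen => hne (h.eq_of_length hlen)
  refine List.prefix_of_prefix_length_le h (List.dropLast_prefix v) ?_
  rw [List.length_dropLast]
  omega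

/-- Forward security of the corrected `CTNodes`: if some node of
`CTNodes(ℓ, T)` is a prefix of the leaf `v_{T''}`, then `T ≤ T''`. -/
theorem ctnodes_forward_secure (ℓ T T'' : ℕ)
    (hT : T < 2 ^ ℓ) (hT'' : T'' < 2 ^ ℓ)
    (h : ∃ v ∈ CTNodes ℓ T, v <+: leaf ℓ T'') :
    T ≤ T'' := by
  obtain ⟨w, hw, hwT⟩ := h
  have le_of_leaf (hleaf : leaf ℓ T <+: leaf ℓ T'') : T ≤ T'' :=
    (leaf_injOn ℓ hT hT'' (hleaf.eq_of_length (by simp only [length_leaf]))).le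
  rcases hw with ⟨⟨p, hp, hp_ne, rfl⟩, hnot⟩ | rfl
  · obtain ⟨q, b, rfl⟩ := (List.eq_nil_or_concat' p).resolve_left hp_ne
    simp only [Parent, List.dropLast_concat] at hwT hnot
    cases b with
    | false => exact (lt_of_siblings_prefix_leaf hT hT'' hp hwT).le
    | true =>
      by_cases heq : q ++ [true] = leaf ℓ T
      · exact le_of_leaf (heq ▸ hwT)
      · exact absurd (prefix_dropLast_of_prefix_of_ne hp heq) hnot
  · exact le_of_leaf hwT
end

section
/- Let ℓ : ℕ and let T : ℕ satisfy T < 2^ℓ. Then CTNodes(ℓ, T) = { v_T } ∪ { w ++ [true] : w : List Bool such that w ++ [false] is a prefix of v_T }. In words, the corrected CTNodes set consists of the leaf v_T together with the right siblings of exactly those path nodes of v_T that are left children. -/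
theorem prefix_iff_eq_or_prefix_dropLast {α : Type*} {p v : List α} :
    p <+: v ↔ p = v ∨ p <+: v.dropLast := by
  rcases List.eq_nil_or_concat v with rfl | ⟨l, a, rfl⟩
  · simp
  · simp [List.prefix_concat_iff]

theorem mem_rightSibling_pathSet {v x : List Bool} :
    x ∈ RightSibling (PathSet v) ↔ ∃ w b, w ++ [b] <+: v ∧ x = w ++ [true] := by
  constructor
  · rintro ⟨p, hp, hne, rfl⟩
    refine ⟨p.dropLast, p.getLast hne, ?_, rfl⟩
    rwa [List.dropLast_append_getLast]
  · rintro ⟨w, b, h, rfl⟩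
    exact ⟨w ++ [b], h, by simp, by simp [Parent]⟩

theorem eq_of_append_singleton_prefix {α : Type*} {w v : List α} {a b : α}
    (ha : w ++ [a] <+: v) (hb : w ++ [b] <+: v) : a = b := by
  have h : w ++ [a] <+: w ++ [b] := List.prefix_of_prefix_length_le ha hb (by simp)
  simpa using h.eq_of_length (by simp)

/-- Explicit description of the corrected `CTNodes` set: it consists of the
leaf `v_T` together with the right siblings of exactly those path nodes of
`v_T` that are left children. -/
theorem ctnodes_eq_leaf_union_rightSiblings (ℓ T : ℕ) (hT : T < 2 ^ ℓ) :
    CTNodes ℓ T =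
      {leaf ℓ T} ∪ {v | ∃ w : List Bool, (w ++ [false]) <+: leaf ℓ T ∧ v = w ++ [true]} := by
  ext x
  simp only [CTNodes, Set.mem_union, Set.mem_sdiff, Set.mem_singleton_iff, Set.mem_ofPred_eq,
    mem_rightSibling_pathSet]
  constructor
  · rintro (⟨⟨w, b, h, rfl⟩, hn⟩ | rfl)
    · cases b
      · exact Or.inr ⟨w, h, rfl⟩
      · exact Or.inl ((prefix_iff_eq_or_prefix_dropLast.mp h).resolve_right hn)
    · exact Or.inl rfl
  · rintro (rfl | ⟨w, h, rfl⟩)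
    · exact Or.inr rfl
    · refine Or.inl ⟨⟨w, false, h, rfl⟩, fun h' => ?_⟩
      exact Bool.false_ne_true
        (eq_of_append_singleton_prefix h (prefix_iff_eq_or_prefix_dropLast.mpr (Or.inr h')))
end

section
/- Let ℓ : ℕ with ℓ ≥ 1, and let T : ℕ satisfy 1 ≤ T < 2^ℓ. Then there exist T'' : ℕ with T'' < T and a bitstring v ∈ WrongCTNodes(ℓ, T) such that v is a prefix of v_{T''}. (Thus Wei et al.'s original definition of CTNodes includes a node that gives access to a leaf for a strictly earlier time, breaking forward security.) -/
/-- Wei et al.'s original (flawed) definition of `CTNodes`: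
`{ v | v ≠ [], |v| ≤ ℓ, Parent(v) ∈ PathSet(v_T), v ∉ PathSet(v_T) } ∪ { v_T }`. -/
def WrongCTNodes (ℓ T : ℕ) : Set (List Bool) :=
  {v | v ≠ [] ∧ v.length ≤ ℓ ∧ Parent v ∈ PathSet (leaf ℓ T) ∧ v ∉ PathSet (leaf ℓ T)} ∪ {leaf ℓ T}

/-- If `b` is not a prefix of `a`, then the shortest prefix of `b` that is not a prefix of `a`
is nonempty, and removing its last entry gives a prefix of `a`. -/
theorem exists_minimal_prefix_not_prefix {α : Type*} {a b : List α} (h : ¬ b <+: a) :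
    ∃ v, v ≠ [] ∧ v <+: b ∧ v.dropLast <+: a ∧ ¬ v <+: a := by
  induction b using List.reverseRecOn with
  | nil => exact absurd List.nil_prefix h
  | append_singleton b x ih =>
    by_cases hb : b <+: a
    · exact ⟨b ++ [x], by simp, List.prefix_rfl, by simpa using hb, h⟩
    · obtain ⟨v, hv, hvb, hva, hnot⟩ := ih hb
      exact ⟨v, hv, hvb.trans (List.prefix_append b [x]), hva, hnot⟩

theorem leaf_inj {ℓ S T : ℕ} (hS : S < 2 ^ ℓ) (hT : T < 2 ^ ℓ) (h : leaf ℓ S = leaf ℓ T) :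
    S = T := by
  refine Nat.eq_of_testBit_eq fun i => ?_
  rcases lt_or_ge i ℓ with hi | hi
  · have hbits := List.map_inj_left.mp h (ℓ - 1 - i) (List.mem_range.mpr (by omega))
    rwa [show ℓ - 1 - (ℓ - 1 - i) = i by omega] at hbits
  · have hpow : 2 ^ ℓ ≤ 2 ^ i := Nat.pow_le_pow_right two_pos hi
    rw [Nat.testBit_lt_two_pow (hS.trans_le hpow), Nat.testBit_lt_two_pow (hT.trans_le hpow)]

/-- Wei et al.'s original `CTNodes` definition breaks forward security: for
`1 ≤ T < 2^ℓ`, some node of `WrongCTNodes(ℓ, T)` is a prefix of the leaf of a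
strictly earlier time `T''`. -/
theorem wrongCTNodes_not_forward_secure (ℓ T : ℕ)
    (hℓ : 1 ≤ ℓ) (hT1 : 1 ≤ T) (hT : T < 2 ^ ℓ) :
    ∃ T'' : ℕ, T'' < T ∧ ∃ v ∈ WrongCTNodes ℓ T, v <+: leaf ℓ T'' := by
  have hnot : ¬ leaf ℓ 0 <+: leaf ℓ T := fun h =>
    (Nat.pos_iff_ne_zero.mp hT1).symm
      (leaf_inj (by positivity) hT (h.eq_of_length (by simp only [length_leaf])))
  obtain ⟨v, hv, hv0, hvT, hvnot⟩ := exists_minimal_prefix_not_prefix hnot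
  exact ⟨0, hT1, v, Or.inl ⟨hv, hv0.length_le.trans_eq (length_leaf ℓ 0), hvT, hvnot⟩, hv0⟩
end

section
/- With the pairing model below, the decryption output satisfies C₀ + e(C₁)(D₁) + e(C₂)(D₂) + e(C)(D₃) = M + ((s̃ - s) * r₁) • e(Fh)(g). (This is the core computation of the paper's Theorem: when a ciphertext created at time T is updated to time T' > T, the ciphertext element used in decryption carries a fresh exponent s̃ instead of s, so the decryption output differs from M by the factor e(F_h(T), g)^{(s̃ - s) r₁}.) -/
/-- Core computation of the paper's Theorem: with a symmetric ℤ-bilinear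
pairing `e`, the decryption output of Wei et al.'s scheme applied to a
ciphertext element carrying a fresh exponent `st` differs from the message
`M` by the factor `((st - s) * r₁) • e(Fh)(g)`. -/
theorem rsibe_decryption_computation
    {G GT : Type*} [AddCommGroup G] [AddCommGroup GT]
    (e : G →+ G →+ GT) (hsym : ∀ a b : G, e a b = e b a)
    (g g₂ Fu Fh : G) (M : GT) (α s st r₀ r₁ : ℤ) :
    (M + s • e (α • g) g₂) + e ((-s) • g) (α • g₂ + r₀ • Fu + r₁ • Fh)
      + e (s • Fu) (r₀ • g) + e (st • Fh) (r₁ • g)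
    = M + ((st - s) * r₁) • e Fh g := by
  simp only [map_add, map_zsmul, AddMonoidHom.coe_smul, Pi.smul_apply, hsym Fu g, hsym Fh g]
  module
end

section
/- With the pairing model below, suppose additionally that the additive order of e(Fh)(g) in G_T is a prime p and that p does not divide (s̃ - s) * r₁. Then the decryption output C₀ + e(C₁)(D₁) + e(C₂)(D₂) + e(C)(D₃) is not equal to M. -/
/-- The paper's Theorem: if the additive order of `e(Fh)(g)` is a prime `p`
not dividing `(st - s) * r₁`, then the decryption output is not the message
`M`; i.e. decryption of an updated ciphertext fails. -/
theorem rsibe_decryption_fails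
    {G GT : Type*} [AddCommGroup G] [AddCommGroup GT]
    (e : G →+ G →+ GT) (hsym : ∀ a b : G, e a b = e b a)
    (g g₂ Fu Fh : G) (M : GT) (α s st r₀ r₁ : ℤ)
    (p : ℕ) (hp : p.Prime) (horder : addOrderOf (e Fh g) = p)
    (hndvd : ¬ ((p : ℤ) ∣ (st - s) * r₁)) :
    (M + s • e (α • g) g₂) + e ((-s) • g) (α • g₂ + r₀ • Fu + r₁ • Fh)
      + e (s • Fu) (r₀ • g) + e (st • Fh) (r₁ • g)
    ≠ M := by
  intro h
  apply hndvd
  rw [← horder, addOrderOf_dvd_iff_zsmul_eq_zero]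
  simp only [map_add, map_zsmul, AddMonoidHom.zsmul_apply,
    hsym g Fu, hsym g Fh] at h
  rw [← sub_eq_zero] at h
  rw [← h]
  module
end
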